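/- arXiv:0907.5047 — 2 statements merged into one kernel-verified Lean document; each statement's English description precedes it below -/
import Mathlib

section
/- Let a : ℝ^n → ℝ be smooth with all derivatives bounded and let u be a Schwartz function on ℝ^n. Then −2∫_{ℝ^n} Δa Re(ū Δ²u) dx = 2 Re ∫_{ℝ^n} ( −(1/2) Δ³a |u|² + Δ²a |∇u|² + ∂_{jk}Δa ∂_j ū ∂_k u − Δa Σ_{j,k} |∂_{jk}u|² ) dx, where repeated indices j,k are summed. -/
open MeasureTheory Real FourierTransform Filter Topology
open scoped ENNReal NNReal

noncomputable section

abbrev Rn (n : ℕ) := EuclideanSpace ℝ (Fin n)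

variable {n : ℕ}

/-- Fourier multiplier operator with symbol `m`. -/
def fmul (m : Rn n → ℂ) (f : Rn n → ℂ) : Rn n → ℂ :=
  𝓕⁻ fun ξ => m ξ * 𝓕 f ξ

/-- The operator `|∇|^σ`. -/
def absGrad (σ : ℝ) (f : Rn n → ℂ) : Rn n → ℂ :=
  fmul (fun ξ => ((‖ξ‖ ^ σ : ℝ) : ℂ)) f

/-- Squared inhomogeneous Sobolev `H^s` norm. -/
def HsNormSq (s : ℝ) (f : Rn n → ℂ) : ℝ≥0∞ :=
  ∫⁻ ξ, ENNReal.ofReal ((1 + ‖ξ‖ ^ 2) ^ s) * (‖𝓕 f ξ‖₊ : ℝ≥0∞) ^ 2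

def HsN (s : ℝ) (f : Rn n → ℂ) : ℝ≥0∞ := (HsNormSq s f) ^ ((1:ℝ)/2)

/-- Squared homogeneous Sobolev `Ḣ^σ` norm. -/
def HdotNormSq (σ : ℝ) (f : Rn n → ℂ) : ℝ≥0∞ :=
  ∫⁻ ξ, ENNReal.ofReal (‖ξ‖ ^ (2 * σ)) * (‖𝓕 f ξ‖₊ : ℝ≥0∞) ^ 2

/-- `L^p` norm. -/
def LpN (p : ℝ) (f : Rn n → ℂ) : ℝ≥0∞ :=
  (∫⁻ x, (‖f x‖₊ : ℝ≥0∞) ^ p) ^ (1 / p)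

/-- Space-time norm `L^q_t L^r_x` on a time set `I`. -/
def SpaceTimeN (q r : ℝ) (I : Set ℝ) (u : ℝ → Rn n → ℂ) : ℝ≥0∞ :=
  (∫⁻ t in I, (LpN r (u t)) ^ q) ^ (1 / q)

/-- partial derivative in the `i`-th coordinate direction -/
def pd (i : Fin n) (f : Rn n → ℂ) (x : Rn n) : ℂ :=
  fderiv ℝ f x (EuclideanSpace.single i 1)

def pdR (i : Fin n) (f : Rn n → ℝ) (x : Rn n) : ℝ :=
  fderiv ℝ f x (EuclideanSpace.single i 1)

def lap (f : Rn n → ℂ) (x : Rn n) : ℂ := ∑ i, pd i (pd i f) x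
def lapR (f : Rn n → ℝ) (x : Rn n) : ℝ := ∑ i, pdR i (pdR i f) x
def bilap (f : Rn n → ℂ) (x : Rn n) : ℂ := lap (fun y => lap f y) x

/-- cubic nonlinearity `|u|²u` -/
def cubic (f : Rn n → ℂ) (x : Rn n) : ℂ := (‖f x‖ : ℂ) ^ 2 * f x

/-- solves the defocusing cubic fourth-order NLS on the time set `I` -/
def Solves4NLS (I : Set ℝ) (u : ℝ → Rn n → ℂ) : Prop :=
  ∀ t ∈ I, ∀ x, Complex.I * deriv (fun τ => u τ x) t + bilap (u t) x + cubic (u t) x = 0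

/-- Schrödinger admissible pair -/
def SAdm (n : ℕ) (q r : ℝ) : Prop := 2 ≤ q ∧ 2 ≤ r ∧ 2 / q = n * (1/2 - 1/r)
/-- biharmonic admissible pair -/
def BAdm (n : ℕ) (q r : ℝ) : Prop := 2 ≤ q ∧ 2 ≤ r ∧ 4 / q = n * (1/2 - 1/r)

open ComplexConjugate LineDeriv SchwartzMap

lemma hasTemperateGrowth_pdR {g : Rn n → ℝ} (hg : g.HasTemperateGrowth) (i : Fin n) :
    (pdR i g).HasTemperateGrowth := by
  have h : (fderiv ℝ g).HasTemperateGrowth := by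
    refine ⟨hg.1.fderiv_right (by simp), fun m => ?_⟩
    obtain ⟨k, C, h⟩ := hg.2 (m + 1)
    exact ⟨k, C, fun x => by rw [norm_iteratedFDeriv_fderiv]; exact h x⟩
  have h2 : (fun L : Rn n →L[ℝ] ℝ => L (EuclideanSpace.single i 1)).HasTemperateGrowth :=
    (ContinuousLinearMap.apply ℝ ℝ (EuclideanSpace.single i (1 : ℝ))).hasTemperateGrowth
  exact h2.comp h

lemma hasTemperateGrowth_lapR {g : Rn n → ℝ} (hg : g.HasTemperateGrowth) :
    (lapR g).HasTemperateGrowth :=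
  Function.HasTemperateGrowth.sum fun i _ =>
    hasTemperateGrowth_pdR (hasTemperateGrowth_pdR hg i) i

lemma pdR_comm {g : Rn n → ℝ} (hg : g.HasTemperateGrowth) (i j : Fin n) :
    pdR i (pdR j g) = pdR j (pdR i g) := by
  ext x
  have hd : DifferentiableAt ℝ (fderiv ℝ g) x :=
    ((hg.1.fderiv_right (m := 1) (by norm_cast)).differentiable (by simp)) x
  have key : ∀ i j : Fin n, pdR i (pdR j g) x =
      fderiv ℝ (fderiv ℝ g) x (EuclideanSpace.single i 1) (EuclideanSpace.single j 1) := by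
    intro i j
    have := (hd.hasFDerivAt.clm_apply
      (hasFDerivAt_const (EuclideanSpace.single j (1 : ℝ)) x)).fderiv
    change fderiv ℝ (fun y => fderiv ℝ g y (EuclideanSpace.single j 1)) x _ = _
    rw [this]
    simp
  rw [key, key]
  exact (hg.1.contDiffAt.isSymmSndFDerivAt (by simp; norm_cast)) _ _

lemma pdR_sum {ι : Type*} (s : Finset ι) {g : ι → Rn n → ℝ}
    (hg : ∀ j, (g j).HasTemperateGrowth) (i : Fin n) :
    pdR i (fun x => ∑ j ∈ s, g j x) = fun x => ∑ j ∈ s, pdR i (g j) x := by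
  ext x
  unfold pdR
  rw [fderiv_fun_sum fun j _ => (hg j).1.differentiable (by simp) x]
  simp

lemma lapR_lapR_apply {g : Rn n → ℝ} (hg : g.HasTemperateGrowth) (x : Rn n) :
    lapR (lapR g) x = ∑ k, ∑ j, pdR k (pdR k (pdR j (pdR j g))) x := by
  have h := fun i j => hasTemperateGrowth_pdR (hasTemperateGrowth_pdR hg j) i
  change ∑ k, pdR k (pdR k (fun y => ∑ j, pdR j (pdR j g) y)) x = _
  refine Finset.sum_congr rfl fun k _ => ?_
  rw [pdR_sum _ (fun j => h j j), pdR_sum _ (fun j => hasTemperateGrowth_pdR (h j j) k)]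

/-- The `i`-th partial derivative of a Schwartz function, as a Schwartz function. -/
def schwartzPd (i : Fin n) (f : 𝓢(Rn n, ℂ)) : 𝓢(Rn n, ℂ) := ∂_{EuclideanSpace.single i (1 : ℝ)} f

lemma pd_coe (i : Fin n) (f : 𝓢(Rn n, ℂ)) : pd i f = schwartzPd i f := rfl

lemma schwartzPd_comm (i j : Fin n) (f : 𝓢(Rn n, ℂ)) :
    schwartzPd i (schwartzPd j f) = schwartzPd j (schwartzPd i f) := by
  ext x
  have hd : DifferentiableAt ℝ (fderiv ℝ f) x :=
    (((f.smooth 2).fderiv_right (m := 1) (by norm_num)).differentiable (by simp)) x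
  have key : ∀ i j : Fin n, schwartzPd i (schwartzPd j f) x =
      fderiv ℝ (fderiv ℝ f) x (EuclideanSpace.single i 1) (EuclideanSpace.single j 1) := by
    intro i j
    have := (hd.hasFDerivAt.clm_apply
      (hasFDerivAt_const (EuclideanSpace.single j (1 : ℝ)) x)).fderiv
    change fderiv ℝ (fun y => fderiv ℝ f y (EuclideanSpace.single j 1)) x _ = _
    rw [this]
    simp
  rw [key, key]
  exact (((f.smooth 2).contDiffAt).isSymmSndFDerivAt (by simp)) _ _

lemma bilap_coe (u : 𝓢(Rn n, ℂ)) (x : Rn n) :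
    bilap u x = ∑ j, ∑ k, schwartzPd j (schwartzPd j (schwartzPd k (schwartzPd k u))) x := by
  have h : (fun y => lap u y) = ⇑(∑ k, schwartzPd k (schwartzPd k u)) := by
    ext y
    simp [lap, pd_coe]
  have hs : ∀ (j : Fin n) (F : Fin n → 𝓢(Rn n, ℂ)),
      schwartzPd j (∑ k, F k) = ∑ k, schwartzPd j (F k) := fun j F => lineDerivOp_sum _ _ _
  unfold bilap
  rw [h]
  simp only [lap, pd_coe, hs, sum_apply]

/-- The weighted sesquilinear pairing `∫ g f̄ h`. -/
def wpair (g : Rn n → ℝ) (f h : 𝓢(Rn n, ℂ)) : ℂ := ∫ x, (g x : ℂ) * conj (f x) * h x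

/-- The real bilinear map `(z, w) ↦ z̄ w`. -/
def conjMul : ℂ →L[ℝ] ℂ →L[ℝ] ℂ := (ContinuousLinearMap.mul ℝ ℂ).comp (Complex.conjCLE : ℂ →L[ℝ] ℂ)

lemma conjMul_apply (z w : ℂ) : conjMul z w = conj z * w := rfl

lemma integrable_wpair {g : Rn n → ℝ} (hg : g.HasTemperateGrowth) (f h : 𝓢(Rn n, ℂ)) :
    Integrable fun x => (g x : ℂ) * conj (f x) * h x := by
  refine (bilinLeftCLM conjMul (smulLeftCLM ℂ g h).hasTemperateGrowth f).integrable.congr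
    (Eventually.of_forall fun x => ?_)
  simp only [bilinLeftCLM_apply, conjMul_apply, smulLeftCLM_apply_apply hg, Complex.real_smul]
  ring

lemma schwartzPd_smulLeftCLM {g : Rn n → ℝ} (hg : g.HasTemperateGrowth) (h : 𝓢(Rn n, ℂ))
    (i : Fin n) (x : Rn n) :
    schwartzPd i (smulLeftCLM ℂ g h) x = (pdR i g x : ℂ) * h x + g x * schwartzPd i h x := by
  change fderiv ℝ (smulLeftCLM ℂ g h) x _ = _
  rw [smulLeftCLM_apply hg]
  have := ((hg.1.differentiable (by simp) x).hasFDerivAt.smul h.differentiableAt.hasFDerivAt).fderiv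
  change fderiv ℝ (fun x => g x • h x) x _ = _
  rw [show (fun x => g x • h x) = g • ⇑h from rfl, this]
  simp [pdR, schwartzPd, lineDerivOp_apply_eq_fderiv, add_comm]

/-- Integration by parts for the weighted pairing. -/
lemma wpair_schwartzPd_right {g : Rn n → ℝ} (hg : g.HasTemperateGrowth) (f h : 𝓢(Rn n, ℂ))
    (i : Fin n) :
    wpair g f (schwartzPd i h) = -wpair (pdR i g) f h - wpair g (schwartzPd i f) h := by
  have key := integral_bilinear_lineDerivOp_right_eq_neg_left (μ := volume) f (smulLeftCLM ℂ g h)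
    conjMul (EuclideanSpace.single i (1 : ℝ))
  have e1 : (∫ x, conjMul (f x) (schwartzPd i (smulLeftCLM ℂ g h) x)) =
      wpair (pdR i g) f h + wpair g f (schwartzPd i h) := by
    unfold wpair
    rw [← integral_add (integrable_wpair (hasTemperateGrowth_pdR hg i) _ _)
      (integrable_wpair hg _ _)]
    refine integral_congr_ae (Eventually.of_forall fun x => ?_)
    simp only [conjMul_apply, schwartzPd_smulLeftCLM hg]
    ring
  have e2 : (∫ x, conjMul (schwartzPd i f x) (smulLeftCLM ℂ g h x)) =
      wpair g (schwartzPd i f) h := by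
    refine integral_congr_ae (Eventually.of_forall fun x => ?_)
    simp only [conjMul_apply, smulLeftCLM_apply_apply hg, Complex.real_smul]
    ring
  change (∫ x, conjMul (f x) (schwartzPd i (smulLeftCLM ℂ g h) x)) =
    -(∫ x, conjMul (schwartzPd i f x) (smulLeftCLM ℂ g h x)) at key
  rw [e1, e2] at key
  linear_combination key

lemma conj_wpair (g : Rn n → ℝ) (f h : 𝓢(Rn n, ℂ)) : conj (wpair g f h) = wpair g h f := by
  unfold wpair
  rw [← integral_conj]
  refine integral_congr_ae (Eventually.of_forall fun x => ?_)
  simp only [map_mul, Complex.conj_conj, Complex.conj_ofReal]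
  ring

lemma wpair_self_schwartzPd_re {g : Rn n → ℝ} (hg : g.HasTemperateGrowth) (f : 𝓢(Rn n, ℂ))
    (i : Fin n) : (wpair g f (schwartzPd i f)).re = -(1 / 2) * (wpair (pdR i g) f f).re := by
  have h1 := congrArg Complex.re (wpair_schwartzPd_right hg f f i)
  have h2 := congrArg Complex.re (conj_wpair g f (schwartzPd i f))
  simp only [Complex.sub_re, Complex.neg_re, Complex.conj_re] at h1 h2
  linarith

lemma wpair_fourth_order_re {b : Rn n → ℝ} (hb : b.HasTemperateGrowth) (u : 𝓢(Rn n, ℂ))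
    (j k : Fin n) :
    (wpair b u (schwartzPd j (schwartzPd j (schwartzPd k (schwartzPd k u))))).re =
      (1 / 2) * (wpair (pdR k (pdR k (pdR j (pdR j b)))) u u).re
      - (wpair (pdR k (pdR j b)) (schwartzPd j u) (schwartzPd k u)).re
      - (1 / 2) * (wpair (pdR j (pdR j b)) (schwartzPd k u) (schwartzPd k u)).re
      - (1 / 2) * (wpair (pdR k (pdR k b)) (schwartzPd j u) (schwartzPd j u)).re
      + (wpair b (schwartzPd k (schwartzPd j u)) (schwartzPd k (schwartzPd j u))).re := by
  have hd := fun i => hasTemperateGrowth_pdR hb i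
  have hdd := fun i l => hasTemperateGrowth_pdR (hd l) i
  have hddd := fun i l m => hasTemperateGrowth_pdR (hdd l m) i
  have c1 : schwartzPd j (schwartzPd k (schwartzPd k u)) =
      schwartzPd k (schwartzPd k (schwartzPd j u)) := by
    rw [schwartzPd_comm j k, schwartzPd_comm j k]
  have r1 := wpair_self_schwartzPd_re (hd k) (schwartzPd j u) k
  have r2 := wpair_self_schwartzPd_re (hd j) (schwartzPd k u) j
  have r3 := wpair_self_schwartzPd_re (hddd j k j) u k
  rw [pdR_comm (hd j) j k] at r3
  have e1 := wpair_schwartzPd_right hb u (schwartzPd j (schwartzPd k (schwartzPd k u))) j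
  have e2 := wpair_schwartzPd_right hb (schwartzPd j u) (schwartzPd k (schwartzPd j u)) k
  have e3 := wpair_schwartzPd_right (hd j) u (schwartzPd k (schwartzPd j u)) k
  have e4 := wpair_schwartzPd_right (hdd k j) u (schwartzPd k u) j
  rw [pdR_comm (hd j) j k] at e4
  rw [schwartzPd_comm j k] at r2 e4
  rw [e1, c1, e2, e3, e4]
  simp only [Complex.sub_re, Complex.neg_re] at *
  linarith

/-- first integration-by-parts identity for the Morawetz computation. -/
theorem stmt_5 (n : ℕ) (a : Rn n → ℝ)
    (ha : ContDiff ℝ (⊤ : ℕ∞) a)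
    (hbd : ∀ k : ℕ, ∃ C : ℝ, ∀ x : Rn n, ‖iteratedFDeriv ℝ k a x‖ ≤ C)
    (u : SchwartzMap (Rn n) ℂ) :
    (-2 : ℝ) * ∫ x : Rn n, lapR a x * ((starRingEnd ℂ) (u x) * bilap (fun y => u y) x).re =
      2 * (∫ x : Rn n,
        (-(1/2 : ℂ) * (lapR (lapR (lapR a)) x : ℂ) * (‖u x‖ : ℂ) ^ 2
          + (lapR (lapR a) x : ℂ) * ∑ j, (‖pd j (fun y => u y) x‖ : ℂ) ^ 2
          + ∑ j, ∑ k, (pdR k (pdR j (lapR a)) x : ℂ) *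
              (starRingEnd ℂ) (pd j (fun y => u y) x) * pd k (fun y => u y) x
          - (lapR a x : ℂ) * ∑ j, ∑ k, (‖pd k (pd j (fun y => u y)) x‖ : ℂ) ^ 2)).re := by
  have hat : a.HasTemperateGrowth :=
    ⟨ha, fun k => (hbd k).imp' (fun _ => 0) fun C hC => ⟨C, by simpa using hC⟩⟩
  set b := lapR a
  have hb : b.HasTemperateGrowth := hasTemperateGrowth_lapR hat
  have hd := fun i => hasTemperateGrowth_pdR hb i
  have hdd := fun i l => hasTemperateGrowth_pdR (hd l) i
  have hdddd := fun i l p q => hasTemperateGrowth_pdR (hasTemperateGrowth_pdR (hdd p q) l) i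
  have hL : ∫ x, b x * ((starRingEnd ℂ) (u x) * bilap (fun y => u y) x).re =
      ∑ j, ∑ k, (wpair b u (schwartzPd j (schwartzPd j (schwartzPd k (schwartzPd k u))))).re := by
    have hi := fun j k =>
      integrable_wpair hb u (schwartzPd j (schwartzPd j (schwartzPd k (schwartzPd k u))))
    simp only [← Complex.re_sum, wpair]
    simp_rw [← integral_finsetSum _ fun k _ => hi _ k]
    rw [← integral_finsetSum _ fun j _ => integrable_finsetSum _ fun k _ => hi j k]
    rw [← RCLike.re_eq_complex_re, ← integral_re
      (integrable_finsetSum _ fun j _ => integrable_finsetSum _ fun k _ => hi j k)]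
    refine integral_congr_ae (Eventually.of_forall fun x => ?_)
    simp only [RCLike.re_eq_complex_re, ← Finset.mul_sum, ← bilap_coe, mul_assoc,
      Complex.re_ofReal_mul]
  have hR : (∫ x : Rn n,
        (-(1/2 : ℂ) * (lapR (lapR b) x : ℂ) * (‖u x‖ : ℂ) ^ 2
          + (lapR b x : ℂ) * ∑ j, (‖pd j (fun y => u y) x‖ : ℂ) ^ 2
          + ∑ j, ∑ k, (pdR k (pdR j b) x : ℂ) *
              (starRingEnd ℂ) (pd j (fun y => u y) x) * pd k (fun y => u y) x
          - (b x : ℂ) * ∑ j, ∑ k, (‖pd k (pd j (fun y => u y)) x‖ : ℂ) ^ 2)) =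
      ∑ j, ∑ k, (-(1 / 2 : ℂ) * wpair (pdR k (pdR k (pdR j (pdR j b)))) u u
        + wpair (pdR k (pdR k b)) (schwartzPd j u) (schwartzPd j u)
        + wpair (pdR k (pdR j b)) (schwartzPd j u) (schwartzPd k u)
        - wpair b (schwartzPd k (schwartzPd j u)) (schwartzPd k (schwartzPd j u))) := by
    have i1 := fun j k => (integrable_wpair (hdddd k k j j) u u).const_mul (-(1 / 2 : ℂ))
    have i2 := fun j k => integrable_wpair (hdd k k) (schwartzPd j u) (schwartzPd j u)
    have i3 := fun j k => integrable_wpair (hdd k j) (schwartzPd j u) (schwartzPd k u)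
    have i4 := fun j k =>
      integrable_wpair hb (schwartzPd k (schwartzPd j u)) (schwartzPd k (schwartzPd j u))
    have hi := fun j k => (((i1 j k).add (i2 j k)).add (i3 j k)).sub (i4 j k)
    have hterm : ∀ j k, -(1 / 2 : ℂ) * wpair (pdR k (pdR k (pdR j (pdR j b)))) u u
        + wpair (pdR k (pdR k b)) (schwartzPd j u) (schwartzPd j u)
        + wpair (pdR k (pdR j b)) (schwartzPd j u) (schwartzPd k u)
        - wpair b (schwartzPd k (schwartzPd j u)) (schwartzPd k (schwartzPd j u)) =
        ∫ x, _ := fun j k => by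
      unfold wpair
      rw [← integral_const_mul, ← integral_add' (i1 j k) (i2 j k),
        ← integral_add' ((i1 j k).add (i2 j k)) (i3 j k),
        ← integral_sub' (((i1 j k).add (i2 j k)).add (i3 j k)) (i4 j k)]
    simp_rw [hterm]
    simp_rw [← integral_finsetSum _ fun k _ => hi _ k]
    rw [← integral_finsetSum _ fun j _ => integrable_finsetSum _ fun k _ => hi j k]
    refine integral_congr_ae (Eventually.of_forall fun x => ?_)
    have hb2 : lapR b x = ∑ k, pdR k (pdR k b) x := rfl
    simp only [pd_coe, lapR_lapR_apply hb, hb2, ← Complex.conj_mul', Complex.ofReal_sum,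
      Pi.add_apply, Pi.sub_apply, Finset.sum_add_distrib, Finset.sum_sub_distrib, mul_assoc,
      ← Finset.mul_sum, ← Finset.sum_mul]
    rw [Finset.sum_comm (f := fun k j => (pdR k (pdR k (pdR j (pdR j b))) x : ℂ))]
  rw [hL, hR]
  have hswap : ∑ j, ∑ k, (wpair (pdR j (pdR j b)) (schwartzPd k u) (schwartzPd k u)).re =
      ∑ j, ∑ k, (wpair (pdR k (pdR k b)) (schwartzPd j u) (schwartzPd j u)).re :=
    Finset.sum_comm
  have hre : ∀ z : ℂ, (-(1 / 2 : ℂ) * z).re = -(1 / 2) * z.re := fun z => by simp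
  simp only [wpair_fourth_order_re hb, Complex.re_sum, Complex.add_re, Complex.sub_re, hre,
    Finset.sum_add_distrib, Finset.sum_sub_distrib, ← Finset.mul_sum, hswap]
  ring
end
end

section
/- Let n ≥ 6. There is a constant C = C(n) such that for every Schwartz function g on ℝ^n, ‖|∇|^{−(n−5)/4} g‖²_{L⁴(ℝ^n)} ≤ C ‖|∇|^{−(n−5)/2}(|g|²)‖_{L²(ℝ^n)}. -/
open MeasureTheory Real FourierTransform Filter Topology
open scoped ENNReal NNReal

noncomputable section

variable {n : ℕ}

/-- The Riesz kernel `‖x - y‖ ^ (-b)`, with value `∞` on the diagonal when `b > 0`. -/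
def rieszKernel (b : ℝ) (x y : Rn n) : ℝ≥0∞ := ‖x - y‖ₑ ^ (-b)

/-- The integral of a nonnegative function against the Riesz kernel. -/
def rieszPotential (b : ℝ) (g : Rn n → ℝ≥0∞) (x : Rn n) : ℝ≥0∞ :=
  ∫⁻ y, rieszKernel b x y * g y

lemma rieszKernel_comm (b : ℝ) (x y : Rn n) : rieszKernel b x y = rieszKernel b y x := by
  rw [rieszKernel, rieszKernel, enorm_sub_rev]

@[fun_prop]
lemma measurable_rieszKernel (b : ℝ) {α : Type*} [MeasurableSpace α] {f g : α → Rn n}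
    (hf : Measurable f) (hg : Measurable g) : Measurable fun p => rieszKernel b (f p) (g p) := by
  unfold rieszKernel
  fun_prop

@[fun_prop]
lemma measurable_rieszPotential (b : ℝ) {g : Rn n → ℝ≥0∞} (hg : Measurable g) :
    Measurable (rieszPotential b g) := by
  unfold rieszPotential
  exact Measurable.lintegral_prod_right' (f := fun p : Rn n × Rn n => rieszKernel b p.1 p.2 * g p.2)
    (by fun_prop)

lemma rieszKernel_le_of_enorm_le {b : ℝ} (hb : 0 ≤ b) {x y u v : Rn n}
    (h : ‖u - v‖ₑ ≤ 2 * ‖x - y‖ₑ) :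
    rieszKernel b x y ≤ 2 ^ b * rieszKernel b u v := by
  have h2 : (2 : ℝ≥0∞) ^ b * 2 ^ (-b) = 1 := by
    rw [← ENNReal.rpow_add _ _ (by simp) (by simp)]; simp
  unfold rieszKernel
  calc ‖x - y‖ₑ ^ (-b) = 2 ^ b * (2 ^ (-b) * ‖x - y‖ₑ ^ (-b)) := by rw [← mul_assoc, h2, one_mul]
    _ = 2 ^ b * (2 * ‖x - y‖ₑ) ^ (-b) := by
      rw [ENNReal.mul_rpow_of_ne_top (by simp) (by simp)]
    _ ≤ 2 ^ b * ‖u - v‖ₑ ^ (-b) := by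
      gcongr 2 ^ b * ?_
      rw [ENNReal.rpow_neg, ENNReal.rpow_neg, ENNReal.inv_le_inv]
      exact ENNReal.rpow_le_rpow h hb

lemma enorm_sub_le_two_mul {x y z : Rn n} (h : ‖x - y‖ₑ ≤ ‖x - z‖ₑ) :
    ‖y - z‖ₑ ≤ 2 * ‖x - z‖ₑ := by
  calc ‖y - z‖ₑ = ‖(x - z) - (x - y)‖ₑ := by congr 1; abel
    _ ≤ ‖x - z‖ₑ + ‖x - y‖ₑ := enorm_sub_le
    _ ≤ 2 * ‖x - z‖ₑ := by rw [two_mul]; gcongr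

lemma rieszKernel_mul_le {b : ℝ} (hb : 0 ≤ b) (x y z : Rn n) :
    rieszKernel b x y * rieszKernel b x z ≤
      2 ^ b * (rieszKernel b x y * rieszKernel b y z + rieszKernel b x z * rieszKernel b z y) := by
  rcases le_total ‖x - y‖ₑ ‖x - z‖ₑ with h | h
  · calc _ ≤ rieszKernel b x y * (2 ^ b * rieszKernel b y z) := by
          gcongr
          exact rieszKernel_le_of_enorm_le hb (enorm_sub_le_two_mul h)
      _ = 2 ^ b * (rieszKernel b x y * rieszKernel b y z) := by ring
      _ ≤ _ := by gcongr; exact le_self_add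
  · calc _ ≤ (2 ^ b * rieszKernel b z y) * rieszKernel b x z := by
          gcongr
          exact rieszKernel_le_of_enorm_le hb (enorm_sub_le_two_mul h)
      _ = 2 ^ b * (rieszKernel b x z * rieszKernel b z y) := by ring
      _ ≤ _ := by gcongr; exact le_add_self

lemma rieszPotential_mul_eq (b c : ℝ) {g h : Rn n → ℝ≥0∞} (hg : Measurable g) (hh : Measurable h)
    (x : Rn n) : rieszPotential b g x * rieszPotential c h x =
      ∫⁻ y, ∫⁻ z, rieszKernel b x y * g y * (rieszKernel c x z * h z) := by
  rw [rieszPotential, rieszPotential, ← lintegral_mul_const _ (by fun_prop)]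
  exact lintegral_congr fun y => (lintegral_const_mul _ (by fun_prop)).symm

/-- The pointwise inequality `(I g)² ≤ C I (g I g)`. -/
lemma rieszPotential_sq_le {b : ℝ} (hb : 0 ≤ b) {g : Rn n → ℝ≥0∞} (hg : Measurable g)
    (x : Rn n) :
    rieszPotential b g x ^ 2 ≤
      2 ^ b * 2 * rieszPotential b (fun y => g y * rieszPotential b g y) x := by
  have key : ∫⁻ y, ∫⁻ z, rieszKernel b x y * g y * (rieszKernel b y z * g z) =
      rieszPotential b (fun y => g y * rieszPotential b g y) x := by
    refine lintegral_congr fun y => ?_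
    rw [lintegral_const_mul _ (by fun_prop), mul_assoc]
    rfl
  calc rieszPotential b g x ^ 2
      = ∫⁻ y, ∫⁻ z, rieszKernel b x y * g y * (rieszKernel b x z * g z) := by
        rw [sq, rieszPotential_mul_eq b b hg hg]
    _ ≤ ∫⁻ y, ∫⁻ z, 2 ^ b * (rieszKernel b x y * g y * (rieszKernel b y z * g z) +
          rieszKernel b x z * g z * (rieszKernel b z y * g y)) := by
        refine lintegral_mono fun y => lintegral_mono fun z => ?_
        calc _ = (rieszKernel b x y * rieszKernel b x z) * (g y * g z) := by ring
          _ ≤ (2 ^ b * (rieszKernel b x y * rieszKernel b y z +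
              rieszKernel b x z * rieszKernel b z y)) * (g y * g z) := by
            gcongr ?_ * _; exact rieszKernel_mul_le hb x y z
          _ = _ := by ring
    _ = 2 ^ b * ((∫⁻ y, ∫⁻ z, rieszKernel b x y * g y * (rieszKernel b y z * g z)) +
          ∫⁻ y, ∫⁻ z, rieszKernel b x z * g z * (rieszKernel b z y * g y)) := by
        rw [← lintegral_add_left, ← lintegral_const_mul]
        · refine lintegral_congr fun y => ?_
          rw [lintegral_const_mul _ (by fun_prop), lintegral_add_left (by fun_prop)]
        · refine Measurable.add ?_ ?_ <;>
          exact Measurable.lintegral_prod_right (by fun_prop)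
        · exact Measurable.lintegral_prod_right (by fun_prop)
    _ = _ := by
        rw [lintegral_lintegral_swap (f := fun y z =>
          rieszKernel b x z * g z * (rieszKernel b z y * g y)) (by fun_prop), key]
        ring

lemma ENNReal.mul_le_sq_add_sq (x y : ℝ≥0∞) : x * y ≤ x ^ 2 + y ^ 2 := by
  rcases le_total x y with h | h
  · calc x * y ≤ y * y := by gcongr
      _ ≤ _ := by rw [← sq]; exact le_add_self
  · calc x * y ≤ x * x := by gcongr
      _ ≤ _ := by rw [← sq]; exact le_self_add

lemma lintegral_mul_le_sqrt {f g : Rn n → ℝ≥0∞} (hf : Measurable f) (hg : Measurable g) :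
    ∫⁻ x, f x * g x ≤ (∫⁻ x, f x ^ 2) ^ (1 / 2 : ℝ) * (∫⁻ x, g x ^ 2) ^ (1 / 2 : ℝ) := by
  have := ENNReal.lintegral_mul_le_Lp_mul_Lq volume Real.HolderConjugate.two_two
    hf.aemeasurable hg.aemeasurable
  simpa using this

lemma lintegral_rieszPotential_sq_le {b c : ℝ} {C : ℝ≥0∞}
    (hC : ∀ y z : Rn n, ∫⁻ x, rieszKernel b x y * rieszKernel b x z ≤ C * rieszKernel c y z)
    {g V : Rn n → ℝ≥0∞} (hg : Measurable g) (hV : Measurable V) :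
    ∫⁻ x, rieszPotential b (fun y => g y * V y) x ^ 2 ≤
      C * 2 * ∫⁻ y, V y ^ 2 * rieszPotential c (fun z => g z ^ 2) y := by
  have key : ∫⁻ y, ∫⁻ z, rieszKernel c y z * (V y ^ 2 * g z ^ 2) =
      ∫⁻ y, V y ^ 2 * rieszPotential c (fun z => g z ^ 2) y := by
    refine lintegral_congr fun y => ?_
    rw [rieszPotential, ← lintegral_const_mul _ (by fun_prop)]
    exact lintegral_congr fun z => by ring
  calc ∫⁻ x, rieszPotential b (fun y => g y * V y) x ^ 2
      = ∫⁻ x, ∫⁻ p : Rn n × Rn n, rieszKernel b x p.1 * (g p.1 * V p.1) *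
          (rieszKernel b x p.2 * (g p.2 * V p.2)) ∂(volume.prod volume) := by
        refine lintegral_congr fun x => ?_
        rw [sq, rieszPotential_mul_eq b b (by fun_prop) (by fun_prop),
          lintegral_prod _ (by fun_prop)]
    _ = ∫⁻ p : Rn n × Rn n, ∫⁻ x, rieszKernel b x p.1 * (g p.1 * V p.1) *
          (rieszKernel b x p.2 * (g p.2 * V p.2)) ∂volume ∂(volume.prod volume) :=
        lintegral_lintegral_swap (by fun_prop)
    _ = ∫⁻ y, ∫⁻ z, ∫⁻ x, rieszKernel b x y * (g y * V y) *
          (rieszKernel b x z * (g z * V z)) := by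
        refine lintegral_prod _ (Measurable.aemeasurable ?_)
        exact Measurable.lintegral_prod_right (by fun_prop)
    _ ≤ ∫⁻ y, ∫⁻ z, C * (rieszKernel c y z * (V y ^ 2 * g z ^ 2) +
          rieszKernel c z y * (V z ^ 2 * g y ^ 2)) := by
        gcongr with y z
        calc _ = ∫⁻ x, (rieszKernel b x y * rieszKernel b x z) * (g y * V y * (g z * V z)) :=
              lintegral_congr fun x => by ring
          _ = (∫⁻ x, rieszKernel b x y * rieszKernel b x z) * ((V y * g z) * (V z * g y)) := by
              rw [lintegral_mul_const _ (by fun_prop)]; ring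
          _ ≤ (C * rieszKernel c y z) * ((V y * g z) ^ 2 + (V z * g y) ^ 2) := by
              gcongr
              · exact hC y z
              · exact ENNReal.mul_le_sq_add_sq _ _
          _ = _ := by rw [rieszKernel_comm c z y]; ring
    _ = C * ((∫⁻ y, ∫⁻ z, rieszKernel c y z * (V y ^ 2 * g z ^ 2)) +
          ∫⁻ y, ∫⁻ z, rieszKernel c z y * (V z ^ 2 * g y ^ 2)) := by
        rw [← lintegral_add_left, ← lintegral_const_mul]
        · refine lintegral_congr fun y => ?_
          rw [lintegral_const_mul _ (by fun_prop), lintegral_add_left (by fun_prop)]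
        · refine Measurable.add ?_ ?_ <;>
          exact Measurable.lintegral_prod_right (by fun_prop)
        · exact Measurable.lintegral_prod_right (by fun_prop)
    _ = _ := by
        rw [lintegral_lintegral_swap (f := fun y z =>
          rieszKernel c z y * (V z ^ 2 * g y ^ 2)) (by fun_prop), key]
        ring

lemma rpow_half_le_of_le_mul {X Y C : ℝ≥0∞} (hX : X ≠ ⊤)
    (h : X ≤ C * (X ^ (1 / 2 : ℝ) * Y)) : X ^ (1 / 2 : ℝ) ≤ C * Y := by
  rcases eq_or_ne X 0 with rfl | h0
  · simp
  have hXX : X ^ (1 / 2 : ℝ) * X ^ (1 / 2 : ℝ) = X := by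
    rw [← ENNReal.rpow_add _ _ h0 hX]; norm_num
  have h1 : X ^ (1 / 2 : ℝ) ≠ 0 := by simp [ENNReal.rpow_eq_zero_iff, h0, hX]
  have h2 : X ^ (1 / 2 : ℝ) ≠ ⊤ := by simp [ENNReal.rpow_eq_top_iff, h0, hX]
  rw [← ENNReal.mul_le_mul_iff_right h1 h2, hXX]
  exact h.trans_eq (by ring)

lemma lintegral_rieszPotential_pow_four_le {b c : ℝ} (hb : 0 ≤ b) {C : ℝ≥0∞}
    (hC : ∀ y z : Rn n, ∫⁻ x, rieszKernel b x y * rieszKernel b x z ≤ C * rieszKernel c y z)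
    {g : Rn n → ℝ≥0∞} (hg : Measurable g) (hfin : ∫⁻ x, rieszPotential b g x ^ 4 ≠ ⊤) :
    (∫⁻ x, rieszPotential b g x ^ 4) ^ (1 / 2 : ℝ) ≤ (2 ^ b * 2) ^ 2 * (C * 2) *
      (∫⁻ x, rieszPotential c (fun y => g y ^ 2) x ^ 2) ^ (1 / 2 : ℝ) := by
  refine rpow_half_le_of_le_mul hfin ?_
  calc ∫⁻ x, rieszPotential b g x ^ 4
      ≤ ∫⁻ x, (2 ^ b * 2) ^ 2 *
          rieszPotential b (fun y => g y * rieszPotential b g y) x ^ 2 := by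
        gcongr with x
        calc rieszPotential b g x ^ 4 = (rieszPotential b g x ^ 2) ^ 2 := by ring
          _ ≤ _ := by
            rw [← mul_pow]; gcongr; exact rieszPotential_sq_le hb hg x
    _ = (2 ^ b * 2) ^ 2 *
          ∫⁻ x, rieszPotential b (fun y => g y * rieszPotential b g y) x ^ 2 :=
        lintegral_const_mul _ (by fun_prop)
    _ ≤ (2 ^ b * 2) ^ 2 * (C * 2 * ∫⁻ y, rieszPotential b g y ^ 2 *
          rieszPotential c (fun z => g z ^ 2) y) := by
        gcongr; exact lintegral_rieszPotential_sq_le hC hg (by fun_prop)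
    _ ≤ (2 ^ b * 2) ^ 2 * (C * 2 * ((∫⁻ y, (rieszPotential b g y ^ 2) ^ 2) ^ (1 / 2 : ℝ) *
          (∫⁻ y, rieszPotential c (fun z => g z ^ 2) y ^ 2) ^ (1 / 2 : ℝ))) := by
        gcongr; exact lintegral_mul_le_sqrt (by fun_prop) (by fun_prop)
    _ = _ := by simp only [← pow_mul, mul_assoc, Nat.reduceMul]
lemma enorm_rpow_eq_ofReal {z : Rn n} (hz : z ≠ 0) (b : ℝ) :
    ‖z‖ₑ ^ b = ENNReal.ofReal (‖z‖ ^ b) := by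
  rw [← ofReal_norm, ENNReal.ofReal_rpow_of_pos (norm_pos_iff.2 hz)]

lemma ae_ne_point (hn : 1 ≤ n) (x : Rn n) : ∀ᵐ z : Rn n, z ≠ x := by
  have : Nonempty (Fin n) := ⟨⟨0, hn⟩⟩
  exact Measure.ae_ne volume x

lemma lintegral_ball_enorm_rpow_ne_top (hn : 1 ≤ n) {b : ℝ} (hb : b < n) :
    ∫⁻ z in Metric.ball (0 : Rn n) 1, ‖z‖ₑ ^ (-b) ≠ ⊤ := by
  have h : IntegrableOn (fun z : Rn n => ‖z‖ ^ (-b)) (Metric.ball 0 1) := by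
    refine integrableOn_ball_of_norm_le_rpow (C := 1) (α := b) (by simpa using hn) (by simpa using hb)
      (ae_of_all _ fun x => ?_) (Measurable.aestronglyMeasurable (by fun_prop))
    rw [Real.norm_of_nonneg (by positivity), one_mul]
  refine ne_of_eq_of_ne (lintegral_congr_ae ?_) h.2.ne
  filter_upwards [ae_restrict_of_ae (ae_ne_point hn 0)] with z hz
  rw [Real.enorm_of_nonneg (by positivity), enorm_rpow_eq_ofReal hz]

lemma lintegral_compl_ball_enorm_rpow_ne_top {s : ℝ} (hs : n < s) :
    ∫⁻ z in (Metric.ball (0 : Rn n) 1)ᶜ, ‖z‖ₑ ^ (-s) ≠ ⊤ := by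
  have hs0 : 0 < s := (Nat.cast_nonneg n).trans_lt hs
  have h : Integrable (fun z : Rn n => 2 ^ s * (1 + ‖z‖) ^ (-s)) :=
    (integrable_one_add_norm (by simpa using hs)).const_mul _
  refine ne_top_of_le_ne_top h.2.ne ?_
  refine (setLIntegral_mono' measurableSet_ball.compl fun z hz => ?_).trans
    (setLIntegral_le_lintegral _ _)
  have hz1 : 1 ≤ ‖z‖ := by simpa using hz
  have hz0 : z ≠ 0 := by rintro rfl; simp at hz1; linarith
  rw [Real.enorm_of_nonneg (by positivity), enorm_rpow_eq_ofReal hz0]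
  apply ENNReal.ofReal_le_ofReal
  have h2 : (2 : ℝ) ^ s * 2 ^ (-s) = 1 := by rw [← Real.rpow_add two_pos]; simp
  calc ‖z‖ ^ (-s) = 2 ^ s * (2 * ‖z‖) ^ (-s) := by
        rw [Real.mul_rpow (by norm_num) (by positivity), ← mul_assoc, h2, one_mul]
    _ ≤ 2 ^ s * (1 + ‖z‖) ^ (-s) := by
        gcongr 2 ^ s * ?_
        exact Real.rpow_le_rpow_of_nonpos (by positivity) (by linarith) (by linarith)

/-- Affine change of variables for the Lebesgue integral. -/
lemma lintegral_eq_rpow_mul_lintegral_comp (y : Rn n) {D : ℝ} (hD : 0 < D) {F : Rn n → ℝ≥0∞}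
    (hF : Measurable F) :
    ∫⁻ x, F x = ENNReal.ofReal D ^ (n : ℝ) * ∫⁻ u, F (y + D • u) := by
  have h1 : ∫⁻ u, F (y + D • u) = ENNReal.ofReal |(D ^ n)⁻¹| * ∫⁻ x, F x := by
    rw [← lintegral_add_left_eq_self F y, ← lintegral_map (f := fun v => F (y + v)) (by fun_prop)
      (measurable_const_smul D), Measure.map_addHaar_smul _ hD.ne', lintegral_smul_measure]
    simp
  have h2 : ENNReal.ofReal D ^ (n : ℝ) * ENNReal.ofReal |(D ^ n)⁻¹| = 1 := by
    rw [ENNReal.rpow_natCast, ← ENNReal.ofReal_pow hD.le, ← ENNReal.ofReal_mul (by positivity),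
      abs_of_nonneg (by positivity), mul_inv_cancel₀ (by positivity), ENNReal.ofReal_one]
  rw [h1, ← mul_assoc, h2, one_mul]

lemma enorm_rpow_mul_enorm_rpow_le {b : ℝ} (hb : 0 ≤ b) {u e : Rn n} (he : 1 ≤ ‖e‖ₑ)
    (h : ‖u‖ₑ ≤ ‖u - e‖ₑ) :
    ‖u‖ₑ ^ (-b) * ‖u - e‖ₑ ^ (-b) ≤
      (Metric.ball 0 1).indicator (fun u => 2 ^ b * ‖u‖ₑ ^ (-b)) u +
      (Metric.ball 0 1)ᶜ.indicator (fun u => ‖u‖ₑ ^ (-(2 * b))) u := by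
  have anti : ∀ {p q : ℝ≥0∞}, p ≤ q → q ^ (-b) ≤ p ^ (-b) := fun h => by
    rw [ENNReal.rpow_neg, ENNReal.rpow_neg, ENNReal.inv_le_inv]
    exact ENNReal.rpow_le_rpow h hb
  by_cases hu : u ∈ Metric.ball 0 1
  · rw [Set.indicator_of_mem hu, Set.indicator_of_notMem (by simpa using hu), add_zero, mul_comm]
    gcongr
    have h1 : (2 : ℝ≥0∞)⁻¹ ≤ ‖u - e‖ₑ := by
      rw [ENNReal.inv_le_iff_le_mul (by simp) (by simp)]
      calc 1 ≤ ‖e‖ₑ := he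
        _ = ‖u - (u - e)‖ₑ := by congr 1; abel
        _ ≤ ‖u‖ₑ + ‖u - e‖ₑ := enorm_sub_le
        _ ≤ 2 * ‖u - e‖ₑ := by rw [two_mul]; gcongr
    calc _ ≤ ((2 : ℝ≥0∞)⁻¹) ^ (-b) := anti h1
      _ = 2 ^ b := by rw [ENNReal.inv_rpow, ENNReal.rpow_neg, inv_inv]
  · have hu1 : 1 ≤ ‖u‖ := by simpa using hu
    have hu0 : ‖u‖ₑ ≠ 0 := by
      rw [enorm_ne_zero]; rintro rfl; simp at hu1; linarith
    rw [Set.indicator_of_notMem hu, Set.indicator_of_mem (by simpa using hu), zero_add]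
    calc _ ≤ ‖u‖ₑ ^ (-b) * ‖u‖ₑ ^ (-b) := by gcongr _ * ?_; exact anti h
      _ = _ := by rw [← ENNReal.rpow_add _ _ hu0 (by simp)]; congr 1; ring

/-- Riesz kernels convolve to a multiple of a Riesz kernel (upper bound). -/
lemma lintegral_rieszKernel_mul_le (hn : 1 ≤ n) {b : ℝ} (hb : 0 ≤ b) (hbn : b < n)
    (hb2 : n < 2 * b) :
    ∃ C : ℝ≥0∞, C ≠ ⊤ ∧ ∀ y z : Rn n,
      ∫⁻ x, rieszKernel b x y * rieszKernel b x z ≤ C * rieszKernel (2 * b - n) y z := by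
  set ψ : Rn n → ℝ≥0∞ := fun u =>
    (Metric.ball 0 1).indicator (fun u => 2 ^ b * ‖u‖ₑ ^ (-b)) u +
      (Metric.ball 0 1)ᶜ.indicator (fun u => ‖u‖ₑ ^ (-(2 * b))) u with hψ
  have hm : Measurable ψ := by
    refine Measurable.add ?_ ?_ <;> refine Measurable.indicator (by fun_prop) ?_
    · exact measurableSet_ball
    · exact measurableSet_ball.compl
  have hψt : ∫⁻ u, ψ u ≠ ⊤ := by
    rw [hψ, lintegral_add_left (Measurable.indicator (by fun_prop) measurableSet_ball),
      lintegral_indicator measurableSet_ball, lintegral_indicator measurableSet_ball.compl,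
      lintegral_const_mul _ (by fun_prop)]
    refine ENNReal.add_ne_top.2 ⟨ENNReal.mul_ne_top ?_ (lintegral_ball_enorm_rpow_ne_top hn hbn),
      lintegral_compl_ball_enorm_rpow_ne_top hb2⟩
    simp [ENNReal.rpow_eq_top_iff]
  refine ⟨1 + 2 * ∫⁻ u, ψ u, ?_, fun y z => ?_⟩
  · exact ENNReal.add_ne_top.2 ⟨by simp, ENNReal.mul_ne_top (by simp) hψt⟩
  rcases eq_or_ne y z with rfl | hyz
  · have : rieszKernel (2 * b - n) y y = ⊤ := by
      simp [rieszKernel, ENNReal.zero_rpow_of_neg (show (n : ℝ) - 2 * b < 0 by linarith)]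
    rw [this, ENNReal.mul_top (by simp)]
    exact le_top
  set D := ‖z - y‖ with hDdef
  have hD : 0 < D := norm_pos_iff.2 (sub_ne_zero.2 hyz.symm)
  have hD0 : ENNReal.ofReal D ≠ 0 := by simpa using hD
  set e := D⁻¹ • (z - y) with he
  have hDe : D • e = z - y := smul_inv_smul₀ hD.ne' _
  have he1 : ‖e‖ₑ = 1 := by
    rw [← ofReal_norm, he, norm_smul, norm_inv, norm_norm, inv_mul_cancel₀ hD.ne',
      ENNReal.ofReal_one]
  have hDen : ‖D‖ₑ = ENNReal.ofReal D := Real.enorm_of_nonneg hD.le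
  have e1 : ∀ u, rieszKernel b (y + D • u) y = ENNReal.ofReal D ^ (-b) * ‖u‖ₑ ^ (-b) := fun u => by
    rw [rieszKernel, add_sub_cancel_left, enorm_smul, hDen,
      ENNReal.mul_rpow_of_ne_top (by simp) (by simp)]
  have e2 : ∀ u, rieszKernel b (y + D • u) z = ENNReal.ofReal D ^ (-b) * ‖u - e‖ₑ ^ (-b) :=
    fun u => by
    have : y + D • u - z = D • (u - e) := by rw [smul_sub, hDe]; abel
    rw [rieszKernel, this, enorm_smul, hDen, ENNReal.mul_rpow_of_ne_top (by simp) (by simp)]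
  have e3 : rieszKernel (2 * b - n) y z =
      ENNReal.ofReal D ^ (n : ℝ) * (ENNReal.ofReal D ^ (-b) * ENNReal.ofReal D ^ (-b)) := by
    rw [rieszKernel, enorm_sub_rev, ← ofReal_norm, ← hDdef, ← ENNReal.rpow_add _ _ hD0 (by simp),
      ← ENNReal.rpow_add _ _ hD0 (by simp)]
    congr 1; ring
  have bound : ∀ u : Rn n, ‖u‖ₑ ^ (-b) * ‖u - e‖ₑ ^ (-b) ≤ ψ u + ψ (u - e) := fun u => by
    rcases le_total ‖u‖ₑ ‖u - e‖ₑ with h | h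
    · exact (enorm_rpow_mul_enorm_rpow_le hb he1.ge h).trans le_self_add
    · have := enorm_rpow_mul_enorm_rpow_le (u := u - e) (e := -e) hb (by simp [he1])
        (by simpa using h)
      rw [sub_neg_eq_add, sub_add_cancel, mul_comm] at this
      exact this.trans le_add_self
  calc ∫⁻ x, rieszKernel b x y * rieszKernel b x z
      = ENNReal.ofReal D ^ (n : ℝ) *
          ∫⁻ u, rieszKernel b (y + D • u) y * rieszKernel b (y + D • u) z :=
        lintegral_eq_rpow_mul_lintegral_comp y hD (by fun_prop)
    _ = ENNReal.ofReal D ^ (n : ℝ) * ∫⁻ u, ENNReal.ofReal D ^ (-b) * ENNReal.ofReal D ^ (-b) *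
          (‖u‖ₑ ^ (-b) * ‖u - e‖ₑ ^ (-b)) := by
        congr 1
        refine lintegral_congr fun u => ?_
        rw [e1, e2]; ring
    _ = (∫⁻ u, ‖u‖ₑ ^ (-b) * ‖u - e‖ₑ ^ (-b)) * rieszKernel (2 * b - n) y z := by
        rw [lintegral_const_mul _ (by fun_prop), e3]; ring
    _ ≤ (∫⁻ u, ψ u + ψ (u - e)) * rieszKernel (2 * b - n) y z := by
        gcongr ?_ * _
        exact lintegral_mono bound
    _ ≤ _ := by
        rw [lintegral_add_left hm, lintegral_sub_right_eq_self ψ, ← two_mul]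
        gcongr
        exact le_add_self

lemma lintegral_mul_sq_le {w f : Rn n → ℝ≥0∞} (hw : Measurable w) (hf : Measurable f) :
    (∫⁻ x, w x * f x) ^ 2 ≤ (∫⁻ x, w x) * ∫⁻ x, w x * f x ^ 2 := by
  have half : ∀ p : ℝ≥0∞, (p ^ (1 / 2 : ℝ)) ^ 2 = p := fun p => by
    rw [← ENNReal.rpow_natCast, ← ENNReal.rpow_mul]; norm_num
  have key := lintegral_mul_le_sqrt (f := fun x => w x ^ (1 / 2 : ℝ))
    (g := fun x => w x ^ (1 / 2 : ℝ) * f x) (by fun_prop) (by fun_prop)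
  simp only [← mul_assoc, ← sq, mul_pow, half] at key
  calc _ ≤ _ := pow_le_pow_left₀ (zero_le) key 2
    _ = _ := by rw [mul_pow, half, half]

lemma lintegral_mul_pow_four_le {w f : Rn n → ℝ≥0∞} (hw : Measurable w) (hf : Measurable f) :
    (∫⁻ x, w x * f x) ^ 4 ≤ (∫⁻ x, w x) ^ 3 * ∫⁻ x, w x * f x ^ 4 := by
  calc (∫⁻ x, w x * f x) ^ 4 = ((∫⁻ x, w x * f x) ^ 2) ^ 2 := by ring
    _ ≤ ((∫⁻ x, w x) * ∫⁻ x, w x * f x ^ 2) ^ 2 := by gcongr; exact lintegral_mul_sq_le hw hf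
    _ = (∫⁻ x, w x) ^ 2 * (∫⁻ x, w x * f x ^ 2) ^ 2 := by ring
    _ ≤ (∫⁻ x, w x) ^ 2 * ((∫⁻ x, w x) * ∫⁻ x, w x * (f x ^ 2) ^ 2) := by
        gcongr; exact lintegral_mul_sq_le hw (by fun_prop)
    _ = _ := by simp only [← pow_mul]; ring

/-- Young's inequality `‖u * v‖₄ ≤ ‖u‖₁ ‖v‖₄` for nonnegative functions. -/
lemma lintegral_conv_pow_four_le {u v : Rn n → ℝ≥0∞} (hu : Measurable u) (hv : Measurable v) :
    ∫⁻ x, (∫⁻ y, u (x - y) * v y) ^ 4 ≤ (∫⁻ x, u x) ^ 4 * ∫⁻ y, v y ^ 4 := by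
  calc ∫⁻ x, (∫⁻ y, u (x - y) * v y) ^ 4
      ≤ ∫⁻ x, (∫⁻ y, u y) ^ 3 * ∫⁻ y, u (x - y) * v y ^ 4 := by
        refine lintegral_mono fun x => ?_
        refine (lintegral_mul_pow_four_le (w := fun y => u (x - y)) (by fun_prop) hv).trans_eq ?_
        rw [lintegral_sub_left_eq_self u x]
    _ = (∫⁻ y, u y) ^ 3 * ∫⁻ x, ∫⁻ y, u (x - y) * v y ^ 4 := by
        refine lintegral_const_mul _ ?_
        exact Measurable.lintegral_prod_right (by fun_prop)
    _ = (∫⁻ y, u y) ^ 3 * ∫⁻ y, ∫⁻ x, u (x - y) * v y ^ 4 := by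
        rw [lintegral_lintegral_swap (by fun_prop)]
    _ = (∫⁻ y, u y) ^ 3 * ∫⁻ y, (∫⁻ x, u x) * v y ^ 4 := by
        congr 1
        refine lintegral_congr fun y => ?_
        rw [lintegral_mul_const _ (by fun_prop), lintegral_sub_right_eq_self u y]
    _ = _ := by rw [lintegral_const_mul _ (by fun_prop)]; ring

lemma add_pow_four_le (p q : ℝ≥0∞) : (p + q) ^ 4 ≤ 16 * p ^ 4 + 16 * q ^ 4 := by
  rcases le_total p q with h | h
  · calc (p + q) ^ 4 ≤ (q + q) ^ 4 := by gcongr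
      _ = 16 * q ^ 4 := by ring
      _ ≤ _ := le_add_self
  · calc (p + q) ^ 4 ≤ (p + p) ^ 4 := by gcongr
      _ = 16 * p ^ 4 := by ring
      _ ≤ _ := le_self_add

/-- The part of the Riesz kernel supported in the unit ball. -/
def nearKernel (b : ℝ) : Rn n → ℝ≥0∞ := (Metric.ball 0 1).indicator fun u => ‖u‖ₑ ^ (-b)

/-- The part of the Riesz kernel supported off the unit ball. -/
def farKernel (b : ℝ) : Rn n → ℝ≥0∞ := (Metric.ball 0 1)ᶜ.indicator fun u => ‖u‖ₑ ^ (-b)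

@[fun_prop]
lemma measurable_nearKernel (b : ℝ) : Measurable (nearKernel b : Rn n → ℝ≥0∞) :=
  Measurable.indicator (by fun_prop) measurableSet_ball

@[fun_prop]
lemma measurable_farKernel (b : ℝ) : Measurable (farKernel b : Rn n → ℝ≥0∞) :=
  Measurable.indicator (by fun_prop) measurableSet_ball.compl

lemma rieszPotential_eq_add (b : ℝ) {g : Rn n → ℝ≥0∞} (hg : Measurable g) (x : Rn n) :
    rieszPotential b g x =
      (∫⁻ y, nearKernel b (x - y) * g y) + ∫⁻ y, farKernel b (x - y) * g y := by
  rw [← lintegral_add_left (by fun_prop)]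
  refine lintegral_congr fun y => ?_
  rw [← add_mul]
  congr 1
  exact congrFun (Set.indicator_self_add_compl (Metric.ball (0 : Rn n) 1)
    (fun u => ‖u‖ₑ ^ (-b))).symm (x - y)

lemma lintegral_nearKernel_ne_top (hn : 1 ≤ n) {b : ℝ} (hb : b < n) :
    ∫⁻ u : Rn n, nearKernel b u ≠ ⊤ := by
  rw [nearKernel, lintegral_indicator measurableSet_ball]
  exact lintegral_ball_enorm_rpow_ne_top hn hb

lemma lintegral_farKernel_pow_four_ne_top {b : ℝ} (hb : n < 4 * b) :
    ∫⁻ u : Rn n, farKernel b u ^ 4 ≠ ⊤ := by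
  have : ∀ u : Rn n, farKernel b u ^ 4 = farKernel (4 * b) u := fun u => by
    by_cases hu : u ∈ (Metric.ball (0 : Rn n) 1)ᶜ
    · rw [farKernel, farKernel, Set.indicator_of_mem hu, Set.indicator_of_mem hu,
        ← ENNReal.rpow_natCast, ← ENNReal.rpow_mul]
      congr 1; push_cast; ring
    · rw [farKernel, farKernel, Set.indicator_of_notMem hu, Set.indicator_of_notMem hu]; simp
  simp only [this]
  rw [farKernel, lintegral_indicator measurableSet_ball.compl]
  exact lintegral_compl_ball_enorm_rpow_ne_top hb

lemma farKernel_le_one {b : ℝ} (hb : 0 ≤ b) (u : Rn n) : farKernel b u ≤ 1 := by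
  refine Set.indicator_le' (g := fun _ => (1 : ℝ≥0∞)) (fun u hu => ?_) (fun u hu => zero_le) u
  have : 1 ≤ ‖u‖ₑ := by
    rw [← ofReal_norm, ENNReal.one_le_ofReal]; simpa using hu
  rw [ENNReal.rpow_neg, ENNReal.inv_le_one]
  simpa using ENNReal.rpow_le_rpow this hb

lemma rieszPotential_ne_top (hn : 1 ≤ n) {b : ℝ} (hb : 0 ≤ b) (hbn : b < n) {g : Rn n → ℝ≥0∞}
    (hg : Measurable g) {M : ℝ≥0∞} (hM : M ≠ ⊤) (hgM : ∀ y, g y ≤ M) (hgi : ∫⁻ y, g y ≠ ⊤)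
    (x : Rn n) : rieszPotential b g x ≠ ⊤ := by
  rw [rieszPotential_eq_add b hg]
  refine ENNReal.add_ne_top.2 ⟨?_, ?_⟩
  · refine ne_top_of_le_ne_top (ENNReal.mul_ne_top (lintegral_nearKernel_ne_top hn hbn) hM) ?_
    calc _ ≤ ∫⁻ y, nearKernel b (x - y) * M := by gcongr; exact hgM _
      _ = _ := by rw [lintegral_mul_const _ (by fun_prop), lintegral_sub_left_eq_self]
  · refine ne_top_of_le_ne_top hgi (lintegral_mono fun y => ?_)
    exact mul_le_of_le_one_left (zero_le) (farKernel_le_one hb _)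

lemma lintegral_rieszPotential_pow_four_ne_top (hn : 1 ≤ n) {b : ℝ} (hbn : b < n)
    (hb4 : n < 4 * b) {g : Rn n → ℝ≥0∞} (hg : Measurable g) (hgi : ∫⁻ y, g y ≠ ⊤)
    (hg4 : ∫⁻ y, g y ^ 4 ≠ ⊤) : ∫⁻ x, rieszPotential b g x ^ 4 ≠ ⊤ := by
  have hN : ∫⁻ x, (∫⁻ y, nearKernel b (x - y) * g y) ^ 4 ≠ ⊤ :=
    ne_top_of_le_ne_top (ENNReal.mul_ne_top
      (ENNReal.pow_ne_top (lintegral_nearKernel_ne_top hn hbn)) hg4)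
      (lintegral_conv_pow_four_le (by fun_prop) hg)
  have hF : ∫⁻ x, (∫⁻ y, farKernel b (x - y) * g y) ^ 4 ≠ ⊤ := by
    have : ∀ x : Rn n, ∫⁻ y, farKernel b (x - y) * g y = ∫⁻ y, g (x - y) * farKernel b y :=
      fun x => by
        rw [← lintegral_sub_left_eq_self _ x]
        refine lintegral_congr fun y => ?_
        rw [sub_sub_cancel, mul_comm]
    simp only [this]
    exact ne_top_of_le_ne_top (ENNReal.mul_ne_top (ENNReal.pow_ne_top hgi)
      (lintegral_farKernel_pow_four_ne_top hb4)) (lintegral_conv_pow_four_le hg (by fun_prop))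
  have hNm : Measurable fun x : Rn n => ∫⁻ y, nearKernel b (x - y) * g y :=
    Measurable.lintegral_prod_right (by fun_prop)
  have hFm : Measurable fun x : Rn n => ∫⁻ y, farKernel b (x - y) * g y :=
    Measurable.lintegral_prod_right (by fun_prop)
  refine ne_top_of_le_ne_top ?_ (lintegral_mono fun x =>
    (rieszPotential_eq_add b hg x ▸ add_pow_four_le _ _ : rieszPotential b g x ^ 4 ≤
      16 * (∫⁻ y, nearKernel b (x - y) * g y) ^ 4 + 16 * (∫⁻ y, farKernel b (x - y) * g y) ^ 4))
  rw [lintegral_add_left (by fun_prop), lintegral_const_mul _ (by fun_prop),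
    lintegral_const_mul _ (by fun_prop)]
  exact ENNReal.add_ne_top.2 ⟨ENNReal.mul_ne_top (by simp) hN, ENNReal.mul_ne_top (by simp) hF⟩

theorem integral_mul_eq_integral_integral_mixture {α : Type*} [MeasurableSpace α]
    {μ : Measure α} [SFinite μ] {k : ℝ → α → ℝ} (hk : Measurable (Function.uncurry k))
    (hk0 : ∀ t, 0 < t → ∀ y, 0 ≤ k t y) {κ : α → ℝ}
    (hκ : ∀ᵐ y ∂μ, IntegrableOn (fun t => k t y) (Set.Ioi 0) ∧
      ∫ t in Set.Ioi (0 : ℝ), k t y = κ y)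
    {h : α → ℂ} (hm : AEStronglyMeasurable h μ)
    (hh : Integrable (fun y => (κ y : ℂ) * h y) μ) :
    ∫ y, (κ y : ℂ) * h y ∂μ = ∫ t in Set.Ioi (0 : ℝ), ∫ y, (k t y : ℂ) * h y ∂μ := by
  have hmeas : AEStronglyMeasurable (fun p : α × ℝ => (k p.2 p.1 : ℂ) * h p.1)
      (μ.prod (volume.restrict (Set.Ioi (0 : ℝ)))) := by
    refine AEStronglyMeasurable.mul ?_ hm.comp_fst
    exact (Complex.measurable_ofReal.comp (hk.comp measurable_swap)).aestronglyMeasurable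
  have hint : Integrable (fun p : α × ℝ => (k p.2 p.1 : ℂ) * h p.1)
      (μ.prod (volume.restrict (Set.Ioi (0 : ℝ)))) := by
    rw [integrable_prod_iff hmeas]
    constructor
    · filter_upwards [hκ] with y hy
      exact hy.1.ofReal.mul_const _
    · refine hh.norm.congr ?_
      filter_upwards [hκ] with y hy
      have h1 : ∫ t in Set.Ioi (0 : ℝ), ‖(k t y : ℂ) * h y‖
          = ∫ t in Set.Ioi (0 : ℝ), k t y * ‖h y‖ := by
        refine setIntegral_congr_fun measurableSet_Ioi fun t ht => ?_
        simp [abs_of_nonneg (hk0 t ht y)]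
      have h2 : 0 ≤ κ y := by
        rw [← hy.2]
        exact setIntegral_nonneg measurableSet_Ioi fun t ht => hk0 t ht y
      rw [h1, integral_mul_const, hy.2]
      simp [abs_of_nonneg h2]
  rw [← integral_integral_swap (f := fun y t => (k t y : ℂ) * h y) hint]
  refine integral_congr_ae ?_
  filter_upwards [hκ] with y hy
  rw [integral_mul_const, ← hy.2]
  congr 1
  exact integral_ofReal.symm

theorem integrableOn_rpow_mul_exp_neg_mul_Ioi {s A : ℝ} (hs : 0 < s) (hA : 0 < A) :
    IntegrableOn (fun t : ℝ => t ^ (s - 1) * rexp (-(A * t))) (Set.Ioi 0) := by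
  have h := integrableOn_rpow_mul_exp_neg_mul_rpow (s := s - 1) (p := 1) (b := A)
    (by linarith) one_pos hA
  simpa using h

theorem integrableOn_integral_rpow_mul_exp_neg_div_Ioi {s A : ℝ} (hs : 0 < s) (hA : 0 < A) :
    IntegrableOn (fun t : ℝ => t ^ (-s - 1) * rexp (-(A / t))) (Set.Ioi 0) ∧
      ∫ t in Set.Ioi (0 : ℝ), t ^ (-s - 1) * rexp (-(A / t)) = (1 / A) ^ s * Real.Gamma s := by
  have key : Set.EqOn (fun x : ℝ => (|(-1 : ℝ)| * x ^ ((-1 : ℝ) - 1)) •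
      ((x ^ (-1 : ℝ)) ^ (s - 1) * rexp (-(A * x ^ (-1 : ℝ)))))
      (fun t : ℝ => t ^ (-s - 1) * rexp (-(A / t))) (Set.Ioi 0) := by
    intro x hx
    have hx : 0 < x := hx
    simp only [smul_eq_mul, abs_neg, abs_one, one_mul]
    rw [← Real.rpow_mul hx.le, ← mul_assoc, ← Real.rpow_add hx, Real.rpow_neg_one,
      ← div_eq_mul_inv]
    congr 2
    ring
  constructor
  · rw [← integrableOn_congr_fun key measurableSet_Ioi]
    exact (integrableOn_Ioi_comp_rpow_iff (fun t : ℝ => t ^ (s - 1) * rexp (-(A * t)))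
      (by norm_num)).2 (integrableOn_rpow_mul_exp_neg_mul_Ioi hs hA)
  · rw [← setIntegral_congr_fun measurableSet_Ioi key,
      integral_comp_rpow_Ioi (fun t : ℝ => t ^ (s - 1) * rexp (-(A * t))) (by norm_num),
      Real.integral_rpow_mul_exp_neg_mul_Ioi hs hA]

theorem one_div_pi_mul_sq_rpow {r : ℝ} (hr : 0 ≤ r) (s : ℝ) :
    (1 / (π * r ^ 2)) ^ s = π ^ (-s) * r ^ (-(2 * s)) := by
  rw [one_div, Real.inv_rpow (by positivity), ← Real.rpow_neg (by positivity),
    Real.mul_rpow pi_pos.le (by positivity), ← Real.rpow_natCast, ← Real.rpow_mul hr]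
  congr 2
  push_cast
  ring

theorem integral_gaussian_mul_fourier {f : Rn n → ℂ} (hf : Integrable f) {t : ℝ} (ht : 0 < t)
    (x : Rn n) :
    ∫ ξ, (rexp (-(π * ‖ξ‖ ^ 2 * t)) : ℂ) * (𝐞 (inner ℝ ξ x) • 𝓕 f ξ)
      = ((t ^ (-((n : ℝ) / 2)) : ℝ) : ℂ) * ∫ y, (rexp (-(π * ‖x - y‖ ^ 2 / t)) : ℂ) * f y := by
  have hb : 0 < ((π * t : ℝ) : ℂ).re := by
    rw [Complex.ofReal_re]; positivity
  have J : Integrable (fun w : Rn n ↦ Complex.exp (-((π * t : ℝ) : ℂ) * ‖w‖ ^ 2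
      + 2 * π * Complex.I * inner ℝ x w)) :=
    GaussianFourier.integrable_cexp_neg_mul_sq_norm_add hb _ _
  have h := VectorFourier.integral_fourierIntegral_smul_eq_flip (L := innerₗ (Rn n))
      Real.continuous_fourierChar continuous_inner J hf
  have h' : ∫ w, 𝓕 (fun w : Rn n ↦ Complex.exp (-((π * t : ℝ) : ℂ) * ‖w‖ ^ 2
      + 2 * π * Complex.I * inner ℝ x w)) w • f w =
      ∫ w : Rn n, Complex.exp (-((π * t : ℝ) : ℂ) * ‖w‖ ^ 2
      + 2 * π * Complex.I * inner ℝ x w) • 𝓕 f w := by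
    simpa using! h
  have hL : ∫ ξ, (rexp (-(π * ‖ξ‖ ^ 2 * t)) : ℂ) * (𝐞 (inner ℝ ξ x) • 𝓕 f ξ)
      = ∫ w : Rn n, Complex.exp (-((π * t : ℝ) : ℂ) * ‖w‖ ^ 2
      + 2 * π * Complex.I * inner ℝ x w) • 𝓕 f w := by
    congr with ξ
    rw [Circle.smul_def, Real.fourierChar_apply, Complex.exp_add, real_inner_comm]
    simp only [smul_eq_mul, Complex.ofReal_exp, ← mul_assoc]
    congr 3
    · push_cast; ring
    · push_cast; ring
  rw [hL, ← h', ← integral_const_mul]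
  congr with y
  rw [fourier_gaussian_innerProductSpace' hb]
  simp only [smul_eq_mul, ← mul_assoc]
  congr 2
  · rw [finrank_euclideanSpace_fin]
    have : (π : ℂ) / ((π * t : ℝ) : ℂ) = ((t⁻¹ : ℝ) : ℂ) := by
      push_cast
      field_simp
    rw [this, Real.rpow_neg ht.le, ← Real.inv_rpow ht.le, Complex.ofReal_cpow (by positivity)]
    push_cast
    rfl
  · push_cast
    congr 1
    have : (t : ℂ) ≠ 0 := by exact_mod_cast ht.ne'
    field_simp

theorem lintegral_enorm_rpow_eq_rieszPotential (hn : 1 ≤ n) (b : ℝ) (f : Rn n → ℂ) (x : Rn n) :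
    ∫⁻ y, ‖((‖x - y‖ ^ (-b) : ℝ) : ℂ) * f y‖ₑ = rieszPotential b (fun y => ‖f y‖ₑ) x := by
  refine lintegral_congr_ae ?_
  filter_upwards [ae_ne_point hn x] with y hy
  have hxy : x - y ≠ 0 := sub_ne_zero.2 hy.symm
  simp only [rieszKernel]
  rw [enorm_mul, enorm_rpow_eq_ofReal hxy, ← ofReal_norm (((‖x - y‖ ^ (-b) : ℝ) : ℂ)),
    Complex.norm_real, Real.norm_of_nonneg (by positivity)]

theorem integrable_norm_sub_rpow_neg_mul (hn : 1 ≤ n) {b : ℝ} (hb : 0 ≤ b) (hbn : b < n)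
    (f : SchwartzMap (Rn n) ℂ) (x : Rn n) :
    Integrable (fun y => ((‖x - y‖ ^ (-b) : ℝ) : ℂ) * f y) := by
  constructor
  · refine AEStronglyMeasurable.mul ?_ f.continuous.aestronglyMeasurable
    exact (by fun_prop : Measurable (fun y : Rn n => ((‖x - y‖ ^ (-b) : ℝ) : ℂ))).aestronglyMeasurable
  · have h := rieszPotential_ne_top hn hb hbn (g := fun y => ‖f y‖ₑ)
      f.continuous.measurable.enorm
      (M := ENNReal.ofReal (SchwartzMap.seminorm ℝ 0 0 f)) ENNReal.ofReal_ne_top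
      (fun y => by
        rw [← ofReal_norm]
        exact ENNReal.ofReal_le_ofReal (SchwartzMap.norm_le_seminorm ℝ f y))
      f.integrable.2.ne x
    rw [HasFiniteIntegral, lintegral_enorm_rpow_eq_rieszPotential hn]
    exact lt_top_iff_ne_top.2 h

/-- On Schwartz functions, `|∇|^{-σ}` is convolution with a multiple of `|x|^{σ-n}`. -/
theorem exists_absGrad_neg_eq_integral (hn : 1 ≤ n) {σ : ℝ} (hσ : 0 < σ) (hσn : σ < n) :
    ∃ c : ℝ, 0 < c ∧ ∀ (f : SchwartzMap (Rn n) ℂ) (x : Rn n),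
      absGrad (-σ) (fun y => f y) x
        = (c : ℂ) * ∫ y, ((‖x - y‖ ^ (-((n : ℝ) - σ)) : ℝ) : ℂ) * f y := by
  set s : ℝ := σ / 2 with hs
  set s' : ℝ := ((n : ℝ) - σ) / 2 with hs'
  have hspos : 0 < s := by positivity
  have hspos' : 0 < s' := by have := sub_pos.2 hσn; positivity
  set c₁ : ℝ := π ^ (-s) * Real.Gamma s with hc₁
  set c₂ : ℝ := π ^ (-s') * Real.Gamma s' with hc₂
  have hc₁pos : 0 < c₁ := mul_pos (by positivity) (Real.Gamma_pos_of_pos hspos)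
  have hc₂pos : 0 < c₂ := mul_pos (by positivity) (Real.Gamma_pos_of_pos hspos')
  refine ⟨c₂ / c₁, by positivity, fun f x => ?_⟩
  have hF : ∀ ξ, 𝓕 (fun y => f y) ξ = (𝓕 f : SchwartzMap (Rn n) ℂ) ξ := fun ξ => rfl
  have hnorm : ∀ᵐ ξ : Rn n, ‖ξ‖ ≠ 0 := by
    filter_upwards [ae_ne_point hn (0 : Rn n)] with ξ hξ
    simpa using hξ
  have e1 : ∫ ξ, ((c₁ * ‖ξ‖ ^ (-σ) : ℝ) : ℂ) * (𝐞 (inner ℝ ξ x) • 𝓕 (fun y => f y) ξ)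
      = ∫ t in Set.Ioi (0 : ℝ), ∫ ξ, ((t ^ (s - 1) * rexp (-(π * ‖ξ‖ ^ 2 * t)) : ℝ) : ℂ)
        * (𝐞 (inner ℝ ξ x) • 𝓕 (fun y => f y) ξ) := by
    have hcont : Continuous fun ξ : Rn n => (𝐞 (inner ℝ ξ x) • 𝓕 (fun y => f y) ξ : ℂ) := by
      have h1 : Continuous fun ξ : Rn n => 𝓕 (fun y => f y) ξ := (𝓕 f).continuous
      have h2 : Continuous fun ξ : Rn n => 𝐞 (inner ℝ ξ x) :=
        Real.continuous_fourierChar.comp (by fun_prop)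
      exact h2.smul h1
    refine integral_mul_eq_integral_integral_mixture (by fun_prop)
      (fun t ht ξ => by positivity) ?_ hcont.aestronglyMeasurable ?_
    · filter_upwards [hnorm] with ξ hξ
      have hpos : 0 < π * ‖ξ‖ ^ 2 := by positivity
      refine ⟨integrableOn_rpow_mul_exp_neg_mul_Ioi hspos hpos, ?_⟩
      rw [Real.integral_rpow_mul_exp_neg_mul_Ioi hspos hpos,
        one_div_pi_mul_sq_rpow (norm_nonneg _), hc₁, show 2 * s = σ by rw [hs]; ring]
      ring
    · have h := (integrable_norm_sub_rpow_neg_mul hn hσ.le hσn (𝓕 f) 0).const_mul (c₁ : ℂ)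
      refine (integrable_norm_iff (by
        refine AEStronglyMeasurable.mul ?_ hcont.aestronglyMeasurable
        exact (by fun_prop : Measurable (fun ξ : Rn n =>
          ((c₁ * ‖ξ‖ ^ (-σ) : ℝ) : ℂ))).aestronglyMeasurable)).1 (h.norm.congr ?_)
      refine Eventually.of_forall fun ξ => ?_
      simp [hF, Circle.norm_smul, mul_assoc]
  have e2 : ∫ y, ((c₂ * ‖x - y‖ ^ (-((n : ℝ) - σ)) : ℝ) : ℂ) * f y
      = ∫ t in Set.Ioi (0 : ℝ), ∫ y, ((t ^ (-s' - 1) * rexp (-(π * ‖x - y‖ ^ 2 / t)) : ℝ) : ℂ)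
        * f y := by
    refine integral_mul_eq_integral_integral_mixture (by fun_prop)
      (fun t ht ξ => by positivity) ?_ f.continuous.aestronglyMeasurable ?_
    · filter_upwards [ae_ne_point hn x] with y hy
      have hxy : 0 < ‖x - y‖ := norm_pos_iff.2 (sub_ne_zero.2 hy.symm)
      have hpos : 0 < π * ‖x - y‖ ^ 2 := by positivity
      have h := integrableOn_integral_rpow_mul_exp_neg_div_Ioi hspos' hpos
      refine ⟨h.1, ?_⟩
      rw [h.2, one_div_pi_mul_sq_rpow (norm_nonneg _), hc₂,
        show 2 * s' = (n : ℝ) - σ by rw [hs']; ring]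
      ring
    · have h := (integrable_norm_sub_rpow_neg_mul hn (sub_pos.2 hσn).le
        (by linarith) f x).const_mul (c₂ : ℂ)
      refine h.congr (Eventually.of_forall fun y => ?_)
      simp [mul_assoc]
  have e3 : ∫ ξ, ((c₁ * ‖ξ‖ ^ (-σ) : ℝ) : ℂ) * (𝐞 (inner ℝ ξ x) • 𝓕 (fun y => f y) ξ)
      = ∫ y, ((c₂ * ‖x - y‖ ^ (-((n : ℝ) - σ)) : ℝ) : ℂ) * f y := by
    rw [e1, e2]
    refine setIntegral_congr_fun measurableSet_Ioi fun t ht => ?_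
    have ht : 0 < t := ht
    simp only [Complex.ofReal_mul, mul_assoc]
    simp only [← mul_assoc (π : ℝ)]
    rw [integral_const_mul, integral_const_mul, integral_gaussian_mul_fourier f.integrable ht,
      ← mul_assoc, ← Complex.ofReal_mul, ← Real.rpow_add ht]
    rw [show s - 1 + -((n : ℝ) / 2) = -s' - 1 by rw [hs, hs']; ring]
  have e4 : absGrad (-σ) (fun y => f y) x
      = ∫ ξ, ((‖ξ‖ ^ (-σ) : ℝ) : ℂ) * (𝐞 (inner ℝ ξ x) • 𝓕 (fun y => f y) ξ) := by
    rw [absGrad, fmul, Real.fourierInv_eq]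
    congr with ξ
    simp only [Circle.smul_def, smul_eq_mul]
    ring
  simp only [Complex.ofReal_mul, mul_assoc] at e3
  rw [integral_const_mul, integral_const_mul, ← e4] at e3
  have : (c₁ : ℂ) ≠ 0 := by exact_mod_cast hc₁pos.ne'
  rw [Complex.ofReal_div, div_mul_eq_mul_div, ← e3]
  field_simp

/-- The Schwartz function `x ↦ |g x| ^ 2`. -/
def schwartzNormSq (g : SchwartzMap (Rn n) ℂ) : SchwartzMap (Rn n) ℂ :=
  SchwartzMap.pairing (ContinuousLinearMap.mul ℝ ℂ) g
    (SchwartzMap.postcompCLM (Complex.conjCLE : ℂ →L[ℝ] ℂ) g)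

theorem schwartzNormSq_apply (g : SchwartzMap (Rn n) ℂ) (x : Rn n) :
    schwartzNormSq g x = ((‖g x‖ ^ 2 : ℝ) : ℂ) := by
  simp [schwartzNormSq, Complex.mul_conj']

theorem enorm_absGrad_neg_le (hn : 1 ≤ n) {σ c : ℝ} (hc : 0 < c) {f : Rn n → ℂ} {x : Rn n}
    (h : absGrad (-σ) f x = (c : ℂ) * ∫ y, ((‖x - y‖ ^ (-((n : ℝ) - σ)) : ℝ) : ℂ) * f y) :
    ‖absGrad (-σ) f x‖ₑ
      ≤ ENNReal.ofReal c * rieszPotential ((n : ℝ) - σ) (fun y => ‖f y‖ₑ) x := by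
  rw [h, enorm_mul, ← ofReal_norm (c : ℂ), Complex.norm_real, Real.norm_of_nonneg hc.le,
    ← lintegral_enorm_rpow_eq_rieszPotential hn]
  gcongr _ * ?_
  exact enorm_integral_le_lintegral_enorm _

theorem enorm_absGrad_neg_normSq_eq (hn : 1 ≤ n) {σ c : ℝ} (hσ : 0 < σ) (hσn : σ < n)
    (hc : 0 < c) (g : SchwartzMap (Rn n) ℂ) {x : Rn n}
    (h : absGrad (-σ) (fun y => schwartzNormSq g y) x
      = (c : ℂ) * ∫ y, ((‖x - y‖ ^ (-((n : ℝ) - σ)) : ℝ) : ℂ) * schwartzNormSq g y) :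
    ‖absGrad (-σ) (fun y => schwartzNormSq g y) x‖ₑ
      = ENNReal.ofReal c * rieszPotential ((n : ℝ) - σ) (fun y => ‖g y‖ₑ ^ 2) x := by
  have hsq : (fun y => ‖g y‖ₑ ^ 2) = fun y => ‖schwartzNormSq g y‖ₑ := by
    funext y
    rw [schwartzNormSq_apply, ← ofReal_norm (((‖g y‖ ^ 2 : ℝ) : ℂ)), Complex.norm_real,
      Real.norm_of_nonneg (by positivity), ENNReal.ofReal_pow (norm_nonneg _), ofReal_norm]
  have hint := integrable_norm_sub_rpow_neg_mul hn (sub_pos.2 hσn).le (by linarith)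
    (schwartzNormSq g) x
  have hreal : ∀ y, ((‖x - y‖ ^ (-((n : ℝ) - σ)) : ℝ) : ℂ) * schwartzNormSq g y
      = ((‖x - y‖ ^ (-((n : ℝ) - σ)) * ‖g y‖ ^ 2 : ℝ) : ℂ) := fun y => by
    rw [schwartzNormSq_apply, ← Complex.ofReal_mul]
  rw [h, enorm_mul, ← ofReal_norm (c : ℂ), Complex.norm_real, Real.norm_of_nonneg hc.le, hsq,
    ← lintegral_enorm_rpow_eq_rieszPotential hn]
  simp only [hreal] at hint ⊢
  congr 1
  have hint' : Integrable fun y => ‖x - y‖ ^ (-((n : ℝ) - σ)) * ‖g y‖ ^ 2 := hint.re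
  rw [integral_complex_ofReal, ← ofReal_norm, Complex.norm_real,
    Real.norm_of_nonneg (integral_nonneg fun y => by positivity),
    ofReal_integral_eq_lintegral_ofReal hint' (Eventually.of_forall fun y => by positivity)]
  refine lintegral_congr fun y => ?_
  rw [← ofReal_norm, Complex.norm_real, Real.norm_of_nonneg (by positivity)]

theorem lintegral_enorm_pow_four_ne_top (g : SchwartzMap (Rn n) ℂ) :
    ∫⁻ x, ‖g x‖ₑ ^ 4 ≠ ⊤ := by
  have h := (eLpNorm_lt_top_iff_lintegral_rpow_enorm_lt_top (p := 4) (by norm_num)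
    (by norm_num)).1 (g.memLp 4).2
  refine ne_of_eq_of_ne (lintegral_congr fun x => ?_) h.ne
  rw [show (4 : ℝ≥0∞).toReal = ((4 : ℕ) : ℝ) by norm_num, ENNReal.rpow_natCast]

theorem sq_LpN_four_le {f : Rn n → ℂ} {c : ℝ≥0∞} {V : Rn n → ℝ≥0∞} (hV : Measurable V)
    (h : ∀ x, ‖f x‖ₑ ≤ c * V x) :
    LpN 4 f ^ 2 ≤ c ^ 2 * (∫⁻ x, V x ^ 4) ^ (1 / 2 : ℝ) := by
  have h1 : ∫⁻ x, (‖f x‖₊ : ℝ≥0∞) ^ (4 : ℝ) ≤ c ^ 4 * ∫⁻ x, V x ^ 4 := by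
    rw [← lintegral_const_mul _ (by fun_prop)]
    refine lintegral_mono fun x => ?_
    rw [← mul_pow, ← ENNReal.rpow_natCast]
    exact ENNReal.rpow_le_rpow (h x) (by norm_num)
  have h2 : LpN 4 f ^ 2 = (∫⁻ x, (‖f x‖₊ : ℝ≥0∞) ^ (4 : ℝ)) ^ (1 / 2 : ℝ) := by
    rw [LpN, ← ENNReal.rpow_natCast, ← ENNReal.rpow_mul]
    norm_num
  rw [h2]
  refine (ENNReal.rpow_le_rpow h1 (by norm_num)).trans (le_of_eq ?_)
  rw [ENNReal.mul_rpow_of_nonneg _ _ (by norm_num), ← ENNReal.rpow_natCast, ← ENNReal.rpow_mul,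
    ← ENNReal.rpow_natCast]
  norm_num

theorem LpN_two_eq {f : Rn n → ℂ} {c : ℝ≥0∞} {W : Rn n → ℝ≥0∞} (hW : Measurable W)
    (h : ∀ x, ‖f x‖ₑ = c * W x) :
    LpN 2 f = c * (∫⁻ x, W x ^ 2) ^ (1 / 2 : ℝ) := by
  have h1 : ∫⁻ x, (‖f x‖₊ : ℝ≥0∞) ^ (2 : ℝ) = c ^ 2 * ∫⁻ x, W x ^ 2 := by
    rw [← lintegral_const_mul _ (by fun_prop)]
    refine lintegral_congr fun x => ?_
    rw [← mul_pow, ← ENNReal.rpow_natCast, ← h x]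
    rfl
  rw [LpN, h1, ENNReal.mul_rpow_of_nonneg _ _ (by norm_num), ← ENNReal.rpow_natCast,
    ← ENNReal.rpow_mul]
  norm_num

/-- Riesz-potential square function lemma:
`‖|∇|^{-(n-5)/4} g‖_{L⁴}² ≤ C ‖|∇|^{-(n-5)/2}(|g|²)‖_{L²}` for `n ≥ 6`. -/
theorem stmt_10 (n : ℕ) (hn : 6 ≤ n) :
    ∃ C : ℝ, 0 < C ∧ ∀ g : SchwartzMap (Rn n) ℂ,
      (LpN 4 (absGrad (-(((n : ℝ) - 5) / 4)) (fun x => g x))) ^ (2:ℕ)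
        ≤ ENNReal.ofReal C *
          LpN 2 (absGrad (-(((n : ℝ) - 5) / 2)) (fun x => ((‖g x‖ ^ 2 : ℝ) : ℂ))) := by
  have hn1 : 1 ≤ n := by omega
  have hn6 : (6 : ℝ) ≤ n := by exact_mod_cast hn
  set b : ℝ := (n : ℝ) - ((n : ℝ) - 5) / 4 with hb
  have hb0 : 0 ≤ b := by rw [hb]; linarith
  have hbn : b < n := by rw [hb]; linarith
  have hb2 : (n : ℝ) < 2 * b := by rw [hb]; linarith
  have hb4 : (n : ℝ) < 4 * b := by rw [hb]; linarith
  obtain ⟨c₁, hc₁, h₁⟩ := exists_absGrad_neg_eq_integral hn1 (σ := ((n : ℝ) - 5) / 4)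
    (by linarith) (by linarith)
  obtain ⟨c₂, hc₂, h₂⟩ := exists_absGrad_neg_eq_integral hn1 (σ := ((n : ℝ) - 5) / 2)
    (by linarith) (by linarith)
  obtain ⟨C, hC, hK⟩ := lintegral_rieszKernel_mul_le hn1 hb0 hbn hb2
  rw [show 2 * b - n = (n : ℝ) - ((n : ℝ) - 5) / 2 by rw [hb]; ring] at hK
  set D : ℝ≥0∞ := (2 ^ b * 2) ^ 2 * (C * 2) with hD
  have hDtop : D ≠ ⊤ := by
    have : (2 : ℝ≥0∞) ^ b ≠ ⊤ := ENNReal.rpow_ne_top_of_nonneg hb0 (by simp)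
    exact ENNReal.mul_ne_top (ENNReal.pow_ne_top (ENNReal.mul_ne_top this (by simp)))
      (ENNReal.mul_ne_top hC (by simp))
  refine ⟨c₁ ^ 2 * (D.toReal + 1) / c₂, by positivity, fun g => ?_⟩
  have hgm : Measurable fun x => ‖g x‖ₑ := g.continuous.measurable.enorm
  have hfin := lintegral_rieszPotential_pow_four_ne_top hn1 hbn hb4 hgm g.integrable.2.ne
    (lintegral_enorm_pow_four_ne_top g)
  have hmain := lintegral_rieszPotential_pow_four_le hb0 hK hgm hfin
  have hL := sq_LpN_four_le (measurable_rieszPotential b hgm)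
    (fun x => enorm_absGrad_neg_le hn1 hc₁ (h₁ g x))
  have hR := LpN_two_eq (measurable_rieszPotential _ (hgm.pow_const 2))
    (fun x => enorm_absGrad_neg_normSq_eq hn1 (by linarith) (by linarith) hc₂ g
      (h₂ (schwartzNormSq g) x))
  simp only [schwartzNormSq_apply] at hR
  rw [hR, ← mul_assoc, ← ENNReal.ofReal_mul (by positivity), div_mul_cancel₀ _ hc₂.ne',
    ENNReal.ofReal_mul (by positivity), ENNReal.ofReal_pow hc₁.le, mul_assoc]
  refine hL.trans ?_
  gcongr ENNReal.ofReal c₁ ^ 2 * ?_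
  refine hmain.trans ?_
  gcongr ?_ * _
  exact (ENNReal.ofReal_toReal hDtop).ge.trans (ENNReal.ofReal_le_ofReal (by linarith))
end
end
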